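/- arXiv:2312.16515 — 2 statements merged into one kernel-verified Lean document; each statement's English description precedes it below -/
import Mathlib

section
/- Let p ∈ {0} ∪ [1,∞) and μ_n, μ ∈ P_p(ℝ^N), n ∈ ℕ. If μ_n → μ in total variation and (when p ≥ 1) ∫ |x|_p^p dμ_n(x) → ∫ |x|_p^p dμ(x), then the quantile processes converge: Q^{μ_n} → Q^μ in L_p(λ^N; ℝ^N) (for p = 0: in λ^N-probability). -/
open MeasureTheory ProbabilityTheory Filter Set
open scoped ENNReal NNReal Topology

/-- Lebesgue measure on `(0,1)`. -/
noncomputable def lambda01 : Measure ℝ := volume.restrict (Set.Ioo (0:ℝ) 1)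

/-- The `N`-fold product of Lebesgue measure on `(0,1)`. -/
noncomputable def lambdaN (N : ℕ) : Measure (Fin N → ℝ) :=
  Measure.pi fun _ => lambda01

/-- The open unit cube `(0,1)^N`. -/
def cube (N : ℕ) : Set (Fin N → ℝ) := {u | ∀ i, u i ∈ Set.Ioo (0:ℝ) 1}

/-- A map is triangular (adapted) if its `k`-th component depends only on the first `k`
coordinates. -/
def Triangular {N : ℕ} (Q : (Fin N → ℝ) → Fin N → ℝ) : Prop :=
  ∀ (k : Fin N) (u v : Fin N → ℝ), (∀ j ≤ k, u j = v j) → Q u k = Q v k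

/-- Monotonicity condition (inc) on a set `s`: the `k`-th component is increasing in the
`k`-th coordinate (the earlier coordinates being fixed). -/
def IncOn {N : ℕ} (Q : (Fin N → ℝ) → Fin N → ℝ) (s : Set (Fin N → ℝ)) : Prop :=
  ∀ k : Fin N, ∀ u ∈ s, ∀ v ∈ s, (∀ j < k, u j = v j) → u k ≤ v k → Q u k ≤ Q v k

/-- Strict monotonicity condition (sinc) on a set `s`. -/
def StrictIncOn {N : ℕ} (Q : (Fin N → ℝ) → Fin N → ℝ) (s : Set (Fin N → ℝ)) : Prop :=
  ∀ k : Fin N, ∀ u ∈ s, ∀ v ∈ s, (∀ j < k, u j = v j) → u k < v k → Q u k < Q v k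

/-- Consistency condition (con) on a set `s`: if changing only the `k`-th coordinate does not
change the `k`-th component, then it does not change any later component `m ≥ k`. -/
def ConOn {N : ℕ} (Q : (Fin N → ℝ) → Fin N → ℝ) (s : Set (Fin N → ℝ)) : Prop :=
  ∀ k m : Fin N, k ≤ m → ∀ u ∈ s, ∀ v ∈ s, (∀ j ≠ k, u j = v j) →
    Q u k = Q v k → Q u m = Q v m

/-- A quantile process: a Borel triangular map satisfying (inc) and (con) on the unit cube. -/
structure IsQuantileProcess {N : ℕ} (Q : (Fin N → ℝ) → Fin N → ℝ) : Prop where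
  measurable : Measurable Q
  triangular : Triangular Q
  inc : IncOn Q (cube N)
  con : ConOn Q (cube N)

/-- The (a.e. unique) quantile process of `μ`, chosen via Hilbert's epsilon operator. -/
noncomputable def quantileProcess {N : ℕ} (μ : Measure (Fin N → ℝ)) :
    (Fin N → ℝ) → Fin N → ℝ :=
  Classical.epsilon fun Q => IsQuantileProcess Q ∧ (lambdaN N).map Q = μ

/-- The cost `|x - y|_p^p = ∑ₖ |xₖ - yₖ|^p`, valued in `ℝ≥0∞`. -/
noncomputable def pCost (p : ℝ) {N : ℕ} (x y : Fin N → ℝ) : ℝ≥0∞ :=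
  ∑ k, ENNReal.ofReal (|x k - y k| ^ p)

/-- The bounded cost `|x - y| ∧ 1` used for `p = 0`. -/
noncomputable def cost0 {N : ℕ} (x y : Fin N → ℝ) : ℝ≥0∞ :=
  ENNReal.ofReal (min ‖x - y‖ 1)

/-- The `L_p(λ^N; ℝ^N)`-distance of two maps `(0,1)^N → ℝ^N`
(for `p = 0` the distance `∫ |f - g| ∧ 1 dλ^N` of convergence in probability). -/
noncomputable def Ldist (p : ℝ) {N : ℕ} (f g : (Fin N → ℝ) → Fin N → ℝ) : ℝ≥0∞ :=
  if p = 0 then ∫⁻ u, cost0 (f u) (g u) ∂(lambdaN N)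
  else (∫⁻ u, pCost p (f u) (g u) ∂(lambdaN N)) ^ p⁻¹

/-- `μ ∈ P_p(ℝ^N)`: a Borel probability measure with finite `p`-th moments
(no moment condition when `p = 0`). -/
def MemPp (p : ℝ) {N : ℕ} (μ : Measure (Fin N → ℝ)) : Prop :=
  IsProbabilityMeasure μ ∧
    (p = 0 ∨ ∫⁻ x, ∑ k, ENNReal.ofReal (|x k| ^ p) ∂μ < ⊤)

/-- `T` is `p`-integrable w.r.t. `λ^N` (no condition when `p = 0`). -/
def FinLp (p : ℝ) {N : ℕ} (T : (Fin N → ℝ) → Fin N → ℝ) : Prop :=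
  p = 0 ∨ ∫⁻ u, ∑ k, ENNReal.ofReal (|T u k| ^ p) ∂(lambdaN N) < ⊤

/-- The Knothe–Rosenblatt distance `KR_p(μ,ν)` (for `p = 0` the metric
`∫ |Q^μ - Q^ν| ∧ 1 dλ^N`). -/
noncomputable def KRdist (p : ℝ) {N : ℕ} (μ ν : Measure (Fin N → ℝ)) : ℝ≥0∞ :=
  Ldist p (quantileProcess μ) (quantileProcess ν)

/-- The total variation distance of two measures. -/
noncomputable def TVdist {α : Type*} [MeasurableSpace α] (μ ν : Measure α) : ℝ≥0∞ :=
  ⨆ (A : Set α) (_ : MeasurableSet A), ((μ A - ν A) + (ν A - μ A))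

instance : IsProbabilityMeasure lambda01 := ⟨by simp [lambda01]⟩

instance (N : ℕ) : IsProbabilityMeasure (lambdaN N) := by
  unfold lambdaN; infer_instance

theorem ae_mem_cube (N : ℕ) : ∀ᵐ u ∂lambdaN N, u ∈ cube N := by
  have h : ∀ i : Fin N, ∀ᵐ u ∂lambdaN N, u i ∈ Ioo (0 : ℝ) 1 := fun i =>
    Measure.tendsto_eval_ae_ae.eventually
      (ae_restrict_mem (μ := (volume : Measure ℝ)) measurableSet_Ioo)
  simpa [cube] using ae_all_iff.2 h

/-- Resampling one coordinate preserves the product measure. -/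
theorem measurePreserving_update {N : ℕ} (k : Fin N) :
    MeasurePreserving (fun z : (Fin N → ℝ) × ℝ => Function.update z.1 k z.2)
      ((lambdaN N).prod lambda01) (lambdaN N) := by
  have hm : Measurable fun z : (Fin N → ℝ) × ℝ => Function.update z.1 k z.2 := by
    refine measurable_pi_iff.2 fun j => ?_
    by_cases h : j = k
    · subst h; simpa using measurable_snd
    · simp only [Function.update_of_ne h]
      fun_prop
  refine ⟨hm, ?_⟩
  refine (Measure.pi_eq fun s hs => ?_).symm
  rw [Measure.map_apply hm (MeasurableSet.univ_pi hs)]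
  have : (fun z : (Fin N → ℝ) × ℝ => Function.update z.1 k z.2) ⁻¹' univ.pi s
      = univ.pi (Function.update s k univ) ×ˢ s k := by
    ext z
    simp only [mem_preimage, mem_univ_pi, mem_prod]
    constructor
    · intro h
      refine ⟨fun j => ?_, by simpa using h k⟩
      by_cases hj : j = k
      · subst hj; simp
      · simpa [Function.update_of_ne hj] using h j
    · rintro ⟨h1, h2⟩ j
      by_cases hj : j = k
      · subst hj; simpa using h2
      · simpa [Function.update_of_ne hj] using h1 j
  rw [this, Measure.prod_prod, lambdaN, Measure.pi_pi,
    ← Finset.prod_erase_mul _ _ (Finset.mem_univ k),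
    ← Finset.prod_erase_mul Finset.univ (fun i => lambda01 (s i)) (Finset.mem_univ k)]
  congr 1
  rw [Function.update_self, measure_univ, mul_one]
  refine Finset.prod_congr rfl fun j hj => ?_
  rw [Function.update_of_ne (Finset.ne_of_mem_erase hj)]

/-- The vector keeping the first `k` coordinates of `x`, padded by zeros. -/
def trunc {N : ℕ} (k : ℕ) (x : Fin N → ℝ) : Fin N → ℝ := fun j => if (j : ℕ) < k then x j else 0

theorem trunc_eq_trunc_iff {N k : ℕ} {x y : Fin N → ℝ} :
    trunc k x = trunc k y ↔ ∀ j : Fin N, (j : ℕ) < k → x j = y j := by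
  constructor
  · intro h j hj
    simpa [trunc, hj] using congrFun h j
  · intro h
    ext j
    by_cases hj : (j : ℕ) < k
    · simp [trunc, hj, h j hj]
    · simp [trunc, hj]

theorem continuous_trunc {N : ℕ} (k : ℕ) : Continuous (trunc k : (Fin N → ℝ) → Fin N → ℝ) := by
  refine continuous_pi fun j => ?_
  by_cases hj : (j : ℕ) < k
  · simpa [trunc, hj] using continuous_apply j
  · simpa [trunc, hj] using continuous_const

theorem measurable_trunc {N : ℕ} (k : ℕ) : Measurable (trunc k : (Fin N → ℝ) → Fin N → ℝ) :=
  (continuous_trunc k).measurable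

theorem trunc_of_lt {N k : ℕ} (x : Fin N → ℝ) {j : Fin N} (hj : (j : ℕ) < k) :
    trunc k x j = x j := if_pos hj

theorem trunc_of_not_lt {N k : ℕ} (x : Fin N → ℝ) {j : Fin N} (hj : ¬(j : ℕ) < k) :
    trunc k x j = 0 := if_neg hj

theorem trunc_zero {N : ℕ} (x : Fin N → ℝ) : trunc 0 x = 0 := by
  ext j; simp [trunc]

theorem trunc_self {N : ℕ} (x : Fin N → ℝ) : trunc N x = x := by
  ext j; simp [trunc]

theorem trunc_succ {N : ℕ} (k : Fin N) (x : Fin N → ℝ) :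
    trunc (k + 1) x = Function.update (trunc k x) k (x k) := by
  ext j
  by_cases hj : j = k
  · subst hj; simp [trunc]
  · have : (j : ℕ) ≠ k := fun h => hj (Fin.ext h)
    rw [Function.update_of_ne hj]
    simp only [trunc]
    congr 1
    simp only [eq_iff_iff]; omega

/-- The left-continuous quantile function of `ν` at levels in `(0,1)`, extended by zero. -/
noncomputable def quantile (ν : Measure ℝ) (v : ℝ) : ℝ :=
  open Classical in if v ∈ Ioo (0 : ℝ) 1 then sInf {x | v ≤ cdf ν x} else 0

theorem quantile_le_iff (ν : Measure ℝ) {v : ℝ} (hv : v ∈ Ioo (0 : ℝ) 1) (x : ℝ) :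
    quantile ν v ≤ x ↔ v ≤ cdf ν x := by
  have hne : {x | v ≤ cdf ν x}.Nonempty :=
    (((tendsto_cdf_atTop ν).eventually (lt_mem_nhds hv.2)).exists).imp fun x hx => hx.le
  have hbdd : BddBelow {x | v ≤ cdf ν x} := by
    obtain ⟨b, hb⟩ := ((tendsto_cdf_atBot ν).eventually (gt_mem_nhds hv.1)).exists
    refine ⟨b, fun y hy => ?_⟩
    by_contra! h
    exact absurd (monotone_cdf ν h.le) (not_le.2 (hb.trans_le hy))
  have hq : quantile ν v = sInf {x | v ≤ cdf ν x} := by simp [quantile, hv.1, hv.2]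
  rw [hq]
  refine ⟨fun h => ?_, fun h => csInf_le hbdd h⟩
  have hright : Tendsto (cdf ν) (𝓝[>] x) (𝓝 (cdf ν x)) :=
    ((cdf ν).right_continuous x).tendsto.mono_left (nhdsWithin_mono _ Ioi_subset_Ici_self)
  refine ge_of_tendsto hright ?_
  filter_upwards [self_mem_nhdsWithin] with y hy
  obtain ⟨z, hz, hzy⟩ := exists_lt_of_csInf_lt hne (h.trans_lt hy)
  exact le_trans hz (monotone_cdf ν hzy.le)

theorem quantile_mono (ν : Measure ℝ) {v w : ℝ} (hv : v ∈ Ioo (0 : ℝ) 1) (hw : w ∈ Ioo (0 : ℝ) 1)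
    (h : v ≤ w) : quantile ν v ≤ quantile ν w :=
  (quantile_le_iff ν hv _).2 (h.trans ((quantile_le_iff ν hw _).1 le_rfl))

theorem measurable_quantile_kernel {α : Type*} [MeasurableSpace α] (κ : Kernel α ℝ)
    [IsMarkovKernel κ] : Measurable fun z : α × ℝ => quantile (κ z.1) z.2 := by
  refine measurable_of_Iic fun x => ?_
  have : (fun z : α × ℝ => quantile (κ z.1) z.2) ⁻¹' Iic x
      = (Prod.snd ⁻¹' Ioo 0 1 ∩ {z | z.2 ≤ (κ z.1).real (Iic x)})
        ∪ ((Prod.snd ⁻¹' Ioo 0 1)ᶜ ∩ {_z | 0 ≤ x}) := by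
    ext z
    by_cases hz : z.2 ∈ Ioo (0 : ℝ) 1
    · have := quantile_le_iff (κ z.1) hz x
      rw [cdf_eq_real] at this
      simp only [mem_preimage, mem_Iic, this]
      simp [hz.1, hz.2]
    · have h0 : quantile (κ z.1) z.2 = 0 := by rw [quantile, if_neg hz]
      have hz' : z ∉ (Prod.snd ⁻¹' Ioo 0 1 : Set (α × ℝ)) := hz
      simp only [mem_preimage, mem_Iic, h0, mem_union, mem_inter_iff, mem_compl_iff]
      simp [hz]
  rw [this]
  have hκ : Measurable fun z : α × ℝ => (κ z.1).real (Iic x) :=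
    ((κ.measurable_coe measurableSet_Iic).comp measurable_fst).ennreal_toReal
  have h1 : MeasurableSet (Prod.snd ⁻¹' Ioo 0 1 : Set (α × ℝ)) := measurable_snd measurableSet_Ioo
  exact (h1.inter (measurableSet_le measurable_snd hκ)).union (h1.compl.inter (.const _))

theorem lambda01_map_quantile (ν : Measure ℝ) [IsProbabilityMeasure ν] :
    lambda01.map (quantile ν) = ν := by
  have hm : Measurable (quantile ν) :=
    (measurable_quantile_kernel (Kernel.const Unit ν)).comp (measurable_prodMk_left (x := ()))
  have : IsProbabilityMeasure (lambda01.map (quantile ν)) :=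
    Measure.isProbabilityMeasure_map hm.aemeasurable
  refine Measure.ext_of_Iic _ _ fun x => ?_
  rw [Measure.map_apply hm measurableSet_Iic, lambda01,
    Measure.restrict_apply (hm measurableSet_Iic), ← ofReal_cdf]
  have : quantile ν ⁻¹' Iic x ∩ Ioo 0 1 = Iic (cdf ν x) ∩ Ioo 0 1 := by
    ext v
    simp only [mem_inter_iff, mem_preimage, mem_Iic, and_congr_left_iff]
    exact fun hv => quantile_le_iff ν hv x
  rw [this, measure_congr (ae_eq_refl (Iic (cdf ν x)) |>.inter Ioo_ae_eq_Icc)]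
  have : Iic (cdf ν x) ∩ Icc 0 1 = Icc 0 (cdf ν x) := by
    ext v
    have := cdf_le_one ν x
    simp only [mem_inter_iff, mem_Iic, mem_Icc]
    constructor
    · rintro ⟨a, b, c⟩; exact ⟨b, a⟩
    · rintro ⟨a, b⟩; exact ⟨b, a, b.trans this⟩
  rw [this, Real.volume_Icc, sub_zero]

theorem map_prodMk_quantile {α : Type*} [MeasurableSpace α] (m : Measure α) [IsProbabilityMeasure m]
    (κ : Kernel α ℝ) [IsMarkovKernel κ] :
    (m.prod lambda01).map (fun z => (z.1, quantile (κ z.1) z.2)) = m ⊗ₘ κ := by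
  have hq := measurable_quantile_kernel κ
  have hm : Measurable fun z : α × ℝ => (z.1, quantile (κ z.1) z.2) := measurable_fst.prodMk hq
  ext s hs
  rw [Measure.map_apply hm hs, Measure.prod_apply (hm hs), Measure.compProd_apply hs]
  refine lintegral_congr fun a => ?_
  have hqa : Measurable (quantile (κ a)) := hq.comp measurable_prodMk_left
  conv_rhs => rw [← lambda01_map_quantile (κ a), Measure.map_apply hqa (measurable_prodMk_left hs)]
  rfl

/-- The Knothe–Rosenblatt construction from the successive conditional quantile functions. -/
noncomputable def knothe {N : ℕ} (κ : Fin N → Kernel (Fin N → ℝ) ℝ) (u : Fin N → ℝ) (k : Fin N) :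
    ℝ :=
  quantile (κ k fun j => if _h : (j : ℕ) < k then knothe κ u j else 0) (u k)
termination_by k

theorem knothe_apply {N : ℕ} (κ : Fin N → Kernel (Fin N → ℝ) ℝ) (u : Fin N → ℝ) (k : Fin N) :
    knothe κ u k = quantile (κ k (trunc k (knothe κ u))) (u k) := by
  rw [knothe]
  congr 2

theorem triangular_knothe {N : ℕ} (κ : Fin N → Kernel (Fin N → ℝ) ℝ) : Triangular (knothe κ) := by
  intro k
  induction k using WellFoundedLT.induction with
  | ind k ih =>
    intro u v huv
    rw [knothe_apply, knothe_apply, huv k le_rfl,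
      trunc_eq_trunc_iff.2 fun j hj => ih j hj u v fun i hi => huv i (hi.trans (Fin.le_def.2 hj.le))]

theorem measurable_knothe {N : ℕ} (κ : Fin N → Kernel (Fin N → ℝ) ℝ) [∀ k, IsMarkovKernel (κ k)] :
    Measurable (knothe κ) := by
  refine measurable_pi_iff.2 fun k => ?_
  induction k using WellFoundedLT.induction with
  | ind k ih =>
    simp only [knothe_apply]
    refine (measurable_quantile_kernel (κ k)).comp (Measurable.prodMk ?_ (measurable_pi_apply k))
    refine measurable_pi_iff.2 fun j => ?_
    change Measurable fun u => trunc k (knothe κ u) j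
    by_cases hj : (j : ℕ) < k
    · simpa only [trunc_of_lt _ hj] using ih j hj
    · simpa only [trunc_of_not_lt _ hj] using measurable_const

theorem isQuantileProcess_knothe {N : ℕ} (κ : Fin N → Kernel (Fin N → ℝ) ℝ)
    [∀ k, IsMarkovKernel (κ k)] : IsQuantileProcess (knothe κ) where
  measurable := measurable_knothe κ
  triangular := triangular_knothe κ
  inc := by
    intro k u hu v hv huv hk
    have : trunc k (knothe κ u) = trunc k (knothe κ v) :=
      trunc_eq_trunc_iff.2 fun j hj => triangular_knothe κ j u v
        fun i hi => huv i (hi.trans_lt hj)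
    rw [knothe_apply, knothe_apply, this]
    exact quantile_mono _ (hu k) (hv k) hk
  con := by
    intro k m _ u _ v _ huv hk
    induction m using WellFoundedLT.induction with
    | ind m ih =>
      rcases lt_trichotomy m k with h | h | h
      · exact triangular_knothe κ m u v fun i hi => huv i (hi.trans_lt h).ne
      · rw [h, hk]
      · rw [knothe_apply, knothe_apply, huv m h.ne',
          trunc_eq_trunc_iff.2 fun j hj => ?_]
        by_cases hkj : k ≤ j
        · exact ih j hj hkj
        · exact triangular_knothe κ j u v fun i hi => huv i (hi.trans_lt (not_le.1 hkj)).ne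

/-- The past of a triangular map is independent of the current coordinate. -/
theorem map_trunc_prodMk {N : ℕ} {Q : (Fin N → ℝ) → Fin N → ℝ} (hQ : Measurable Q)
    (ht : Triangular Q) (k : Fin N) :
    (lambdaN N).map (fun u => (trunc k (Q u), u k))
      = ((lambdaN N).map fun u => trunc k (Q u)).prod lambda01 := by
  have h1 : Measurable fun u => trunc k (Q u) := (measurable_trunc k).comp hQ
  have hm : Measurable fun u : Fin N → ℝ => (trunc k (Q u), u k) :=
    h1.prodMk (measurable_pi_apply k)
  rw [← (measurePreserving_update k).map_eq,
    Measure.map_map hm (measurePreserving_update k).measurable]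
  have : (fun u : Fin N → ℝ => (trunc k (Q u), u k)) ∘
      (fun z : (Fin N → ℝ) × ℝ => Function.update z.1 k z.2)
      = Prod.map (fun u => trunc k (Q u)) id := by
    ext1 z
    refine Prod.ext ?_ (Function.update_self _ _ _)
    refine trunc_eq_trunc_iff.2 fun j hj => ht j _ _ fun i hi => ?_
    exact Function.update_of_ne (hi.trans_lt hj).ne _ _
  rw [this, ← Measure.map_prod_map _ _ h1 measurable_id, Measure.map_id,
    (measurePreserving_update k).map_eq]

theorem exists_isQuantileProcess {N : ℕ} (μ : Measure (Fin N → ℝ)) [IsProbabilityMeasure μ] :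
    ∃ Q, IsQuantileProcess Q ∧ (lambdaN N).map Q = μ := by
  let κ : Fin N → Kernel (Fin N → ℝ) ℝ := fun k => condDistrib (fun x => x k) (trunc k) μ
  have hκ : ∀ k, IsMarkovKernel (κ k) := fun k => by dsimp only [κ]; infer_instance
  refine ⟨knothe κ, isQuantileProcess_knothe κ, ?_⟩
  have hQ := measurable_knothe κ
  have key : ∀ k : ℕ, k ≤ N →
      (lambdaN N).map (fun u => trunc k (knothe κ u)) = μ.map (trunc k) := by
    intro k
    induction k with
    | zero =>
      intro _
      have : (trunc 0 : (Fin N → ℝ) → Fin N → ℝ) = fun _ => 0 := funext trunc_zero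
      simp only [this, Measure.map_const, measure_univ]
    | succ k ih =>
      intro hk
      specialize ih (by omega)
      let k' : Fin N := ⟨k, hk⟩
      have hup : Measurable fun z : (Fin N → ℝ) × ℝ => Function.update z.1 k' z.2 :=
        (measurePreserving_update k').measurable
      have hpair : (lambdaN N).map (fun u => (trunc k (knothe κ u), knothe κ u k'))
          = μ.map (fun x => (trunc k x, x k')) := by
        have hcd := compProd_map_condDistrib (X := (trunc k : (Fin N → ℝ) → Fin N → ℝ)) (μ := μ)
          (mβ := inferInstance) (measurable_pi_apply k').aemeasurable
        have hprob : IsProbabilityMeasure (μ.map (trunc k)) :=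
          Measure.isProbabilityMeasure_map (measurable_trunc k).aemeasurable
        rw [← hcd, ← map_prodMk_quantile (μ.map (trunc k)) (κ k'), ← ih,
          ← map_trunc_prodMk hQ (triangular_knothe κ) k', Measure.map_map]
        · congr 1
          ext1 u
          simp only [Function.comp_apply]
          rw [knothe_apply κ u k']
        · exact measurable_fst.prodMk (measurable_quantile_kernel (κ k'))
        · exact ((measurable_trunc k).comp hQ).prodMk (measurable_pi_apply k')
      have h1 : (fun u => trunc (k + 1) (knothe κ u))
          = (fun z : (Fin N → ℝ) × ℝ => Function.update z.1 k' z.2) ∘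
            fun u => (trunc k (knothe κ u), knothe κ u k') := by
        ext1 u; exact trunc_succ k' _
      have h2 : (trunc (k + 1) : (Fin N → ℝ) → Fin N → ℝ)
          = (fun z : (Fin N → ℝ) × ℝ => Function.update z.1 k' z.2) ∘
            fun x => (trunc k x, x k') := by
        ext1 u; exact trunc_succ k' _
      rw [h1, h2, ← Measure.map_map hup, hpair, Measure.map_map hup]
      · exact (measurable_trunc k).prodMk (measurable_pi_apply k')
      · exact ((measurable_trunc k).comp hQ).prodMk ((measurable_pi_apply k').comp hQ)
  have := key N le_rfl
  simp only [trunc_self] at this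
  rw [this]
  have hid : (trunc N : (Fin N → ℝ) → Fin N → ℝ) = id := funext trunc_self
  rw [hid, Measure.map_id]

theorem quantileProcess_spec {N : ℕ} (μ : Measure (Fin N → ℝ)) [IsProbabilityMeasure μ] :
    IsQuantileProcess (quantileProcess μ) ∧ (lambdaN N).map (quantileProcess μ) = μ :=
  Classical.epsilon_spec (exists_isQuantileProcess μ)

section TotalVariation

variable {α : Type*} [MeasurableSpace α]

theorem sub_le_TVdist (μ ν : Measure α) {s : Set α} (hs : MeasurableSet s) :
    μ s - ν s ≤ TVdist μ ν :=
  le_self_add.trans (le_iSup₂ (f := fun (A : Set α) (_ : MeasurableSet A) =>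
    (μ A - ν A) + (ν A - μ A)) s hs)

theorem TVdist_ne_top (μ ν : Measure α) [IsProbabilityMeasure μ] [IsProbabilityMeasure ν] :
    TVdist μ ν ≠ ⊤ := by
  have : TVdist μ ν ≤ 1 + 1 :=
    iSup₂_le fun A _ => add_le_add (tsub_le_self.trans prob_le_one) (tsub_le_self.trans prob_le_one)
  exact ne_top_of_le_ne_top (by simp) this

theorem lintegral_le_add_TVdist (μ ν : Measure α) [IsFiniteMeasure μ] [IsFiniteMeasure ν]
    {f : α → ℝ≥0∞} (hf : ∀ x, f x ≤ 1) :
    ∫⁻ x, f x ∂μ ≤ ∫⁻ x, f x ∂ν + TVdist μ ν := by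
  obtain ⟨s, hs⟩ := exists_isHahnDecomposition μ ν
  have hdiff : ∫⁻ x, f x ∂(μ.restrict sᶜ - ν.restrict sᶜ) ≤ TVdist μ ν := by
    calc ∫⁻ x, f x ∂(μ.restrict sᶜ - ν.restrict sᶜ)
        ≤ ∫⁻ _, 1 ∂(μ.restrict sᶜ - ν.restrict sᶜ) := lintegral_mono hf
      _ = μ sᶜ - ν sᶜ := by
        rw [lintegral_one, Measure.sub_apply MeasurableSet.univ hs.ge_on_compl]
        simp
      _ ≤ TVdist μ ν := sub_le_TVdist μ ν hs.measurableSet.compl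
  calc ∫⁻ x, f x ∂μ = ∫⁻ x in s, f x ∂μ + ∫⁻ x in sᶜ, f x ∂μ :=
        (lintegral_add_compl f hs.measurableSet).symm
    _ ≤ ∫⁻ x in s, f x ∂ν + (TVdist μ ν + ∫⁻ x in sᶜ, f x ∂ν) := by
        refine add_le_add (lintegral_mono' hs.le_on le_rfl) ?_
        conv_lhs => rw [← Measure.sub_add_cancel_of_le hs.ge_on_compl, lintegral_add_measure]
        exact add_le_add hdiff le_rfl
    _ = ∫⁻ x, f x ∂ν + TVdist μ ν := by
        rw [← lintegral_add_compl f hs.measurableSet (μ := ν)]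
        ring

theorem integral_le_add_TVdist (μ ν : Measure α) [IsProbabilityMeasure μ] [IsProbabilityMeasure ν]
    {f : α → ℝ} (hf : Measurable f) {C : ℝ} (hC : 0 < C) (hfC : ∀ x, |f x| ≤ C) :
    ∫ x, f x ∂μ ≤ ∫ x, f x ∂ν + 2 * C * (TVdist μ ν).toReal := by
  have hint : ∀ (m : Measure α) [IsProbabilityMeasure m], Integrable f m := fun m _ =>
    Integrable.of_bound hf.aestronglyMeasurable C (ae_of_all _ fun x => hfC x)
  have h0 : ∀ x, 0 ≤ (f x + C) / (2 * C) := fun x =>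
    div_nonneg (by linarith [(abs_le.1 (hfC x)).1]) (by linarith)
  have h1 : ∀ x, ENNReal.ofReal ((f x + C) / (2 * C)) ≤ 1 := fun x => by
    rw [ENNReal.ofReal_le_one, div_le_one (by linarith)]
    linarith [(abs_le.1 (hfC x)).2]
  have hval : ∀ (m : Measure α) [IsProbabilityMeasure m],
      ∫⁻ x, ENNReal.ofReal ((f x + C) / (2 * C)) ∂m
        = ENNReal.ofReal ((∫ x, f x ∂m + C) / (2 * C)) := fun m _ => by
    have hi : Integrable (fun x => (f x + C) / (2 * C)) m :=
      ((hint m).add (integrable_const C)).div_const _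
    rw [← ofReal_integral_eq_lintegral_ofReal hi (ae_of_all _ h0)]
    congr 1
    rw [integral_div]
    congr 1
    simpa using integral_add (hint m) (integrable_const C)
  have key := lintegral_le_add_TVdist μ ν h1
  have hnn : ∀ (m : Measure α) [IsProbabilityMeasure m], 0 ≤ (∫ x, f x ∂m + C) / (2 * C) :=
    fun m _ => by
      refine div_nonneg ?_ (by linarith)
      have := norm_integral_le_of_norm_le_const (μ := m) (f := f) (C := C) (ae_of_all _ hfC)
      simp only [probReal_univ, mul_one, Real.norm_eq_abs] at this
      linarith [(abs_le.1 this).1]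
  rw [hval μ, hval ν, ← ENNReal.ofReal_toReal (TVdist_ne_top μ ν),
    ← ENNReal.ofReal_add (hnn ν) ENNReal.toReal_nonneg,
    ENNReal.ofReal_le_ofReal_iff (add_nonneg (hnn ν) ENNReal.toReal_nonneg),
    div_add' _ _ _ (by linarith), div_le_div_iff_of_pos_right (by linarith)] at key
  linarith

end TotalVariation

/-- The indicator of `x ≤ t`. -/
noncomputable def leInd (t x : ℝ) : ℝ := if x ≤ t then 1 else 0

theorem leInd_nonneg (t x : ℝ) : 0 ≤ leInd t x := by unfold leInd; split_ifs <;> norm_num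

theorem leInd_le_one (t x : ℝ) : leInd t x ≤ 1 := by unfold leInd; split_ifs <;> norm_num

theorem leInd_antitone (t : ℝ) : Antitone (leInd t) := by
  intro x y h
  unfold leInd
  split_ifs <;> linarith

theorem measurable_leInd : Measurable fun z : ℝ × ℝ => leInd z.1 z.2 :=
  Measurable.ite (measurableSet_le measurable_snd measurable_fst) measurable_const measurable_const

theorem abs_leInd_sub_le_one (t x y : ℝ) : |leInd t x - leInd t y| ≤ 1 :=
  abs_sub_le_of_nonneg_of_le (leInd_nonneg t x) (leInd_le_one t x) (leInd_nonneg t y)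
    (leInd_le_one t y)

/-- The conditional probability of `Q_k ≤ t` given the other coordinates of `u`. -/
noncomputable def levelProb {N : ℕ} (Q : (Fin N → ℝ) → Fin N → ℝ) (k : Fin N) (t : ℝ)
    (u : Fin N → ℝ) : ℝ :=
  ∫ v, leInd t (Q (Function.update u k v) k) ∂lambda01

section LevelProb

variable {N : ℕ} {Q R : (Fin N → ℝ) → Fin N → ℝ} (k : Fin N) (t : ℝ)

theorem measurable_leInd_comp (hQ : Measurable Q) : Measurable fun u => leInd t (Q u k) :=
  measurable_leInd.comp (measurable_const.prodMk ((measurable_pi_apply k).comp hQ))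

theorem measurable_levelProb (hQ : Measurable Q) : Measurable (levelProb Q k t) := by
  have : Measurable fun z : (Fin N → ℝ) × ℝ => leInd t (Q (Function.update z.1 k z.2) k) :=
    (measurable_leInd_comp k t hQ).comp (measurePreserving_update k).measurable
  exact this.stronglyMeasurable.integral_prod_right.measurable

theorem levelProb_nonneg (u : Fin N → ℝ) : 0 ≤ levelProb Q k t u :=
  integral_nonneg fun _ => leInd_nonneg _ _

theorem levelProb_le_one (u : Fin N → ℝ) : levelProb Q k t u ≤ 1 := by
  have := norm_integral_le_of_norm_le_const (μ := lambda01) (C := 1)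
    (f := fun v => leInd t (Q (Function.update u k v) k))
    (ae_of_all _ fun v => by
      rw [Real.norm_of_nonneg (leInd_nonneg _ _)]; exact leInd_le_one _ _)
  simpa [levelProb] using (le_abs_self _).trans this

theorem integrable_levelProb (hQ : Measurable Q) : Integrable (levelProb Q k t) (lambdaN N) :=
  Integrable.of_bound (measurable_levelProb k t hQ).aestronglyMeasurable 1 (ae_of_all _ fun u => by
    rw [Real.norm_of_nonneg (levelProb_nonneg k t u)]; exact levelProb_le_one k t u)

theorem integrable_leInd_update (hQ : Measurable Q) (u : Fin N → ℝ) :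
    Integrable (fun v => leInd t (Q (Function.update u k v) k)) lambda01 :=
  Integrable.of_bound
    ((measurable_leInd_comp k t hQ).comp (measurable_update u)).aestronglyMeasurable 1
    (ae_of_all _ fun v => by
      rw [Real.norm_of_nonneg (leInd_nonneg _ _)]; exact leInd_le_one _ _)

/-- Integrating out one coordinate. -/
theorem integral_eq_integral_update {f : (Fin N → ℝ) → ℝ} (hf : Measurable f) {C : ℝ}
    (hC : ∀ u, |f u| ≤ C) :
    ∫ u, f u ∂lambdaN N = ∫ u, ∫ v, f (Function.update u k v) ∂lambda01 ∂lambdaN N := by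
  have hm := (measurePreserving_update k).measurable
  have hint : Integrable (fun z : (Fin N → ℝ) × ℝ => f (Function.update z.1 k z.2))
      ((lambdaN N).prod lambda01) :=
    Integrable.of_bound (hf.comp hm).aestronglyMeasurable C (ae_of_all _ fun z => hC _)
  conv_lhs => rw [← (measurePreserving_update k).map_eq]
  rw [integral_map hm.aemeasurable hf.aestronglyMeasurable, integral_prod _ hint]

theorem trunc_update (ht : Triangular Q) (u : Fin N → ℝ) (v : ℝ) :
    trunc k (Q (Function.update u k v)) = trunc k (Q u) :=
  trunc_eq_trunc_iff.2 fun j hj => ht j _ _ fun _ hi =>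
    Function.update_of_ne (hi.trans_lt (Fin.lt_def.2 hj)).ne _ _

theorem integral_mul_leInd_sub (hQ : Measurable Q) (ht : Triangular Q)
    {φ g : (Fin N → ℝ) → ℝ} (hφ : Measurable φ) (hg : Measurable g) (hφ1 : ∀ x, |φ x| ≤ 1)
    {C : ℝ} (hgC : ∀ x, |g x| ≤ C) :
    ∫ u, φ (trunc k (Q u)) * (leInd t (Q u k) - g (trunc k (Q u))) ∂lambdaN N
      = ∫ u, φ (trunc k (Q u)) * (levelProb Q k t u - g (trunc k (Q u))) ∂lambdaN N := by
  have hT : Measurable fun u => trunc k (Q u) := (measurable_trunc k).comp hQ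
  rw [integral_eq_integral_update k (C := 1 + C)]
  · refine integral_congr_ae (ae_of_all _ fun u => ?_)
    simp only [trunc_update k ht]
    rw [integral_const_mul, integral_sub (integrable_leInd_update k t hQ u) (integrable_const _)]
    simp [levelProb]
  · exact (hφ.comp hT).mul ((measurable_leInd_comp k t hQ).sub (hg.comp hT))
  · intro u
    rw [abs_mul]
    have h1 : |leInd t (Q u k) - g (trunc k (Q u))| ≤ 1 + C :=
      (abs_sub _ _).trans (add_le_add
        ((abs_of_nonneg (leInd_nonneg _ _)).trans_le (leInd_le_one _ _)) (hgC _))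
    calc _ ≤ 1 * (1 + C) := mul_le_mul (hφ1 _) h1 (abs_nonneg _) zero_le_one
      _ = 1 + C := one_mul _

theorem mem_cube_update {u : Fin N → ℝ} (hu : u ∈ cube N) {v : ℝ} (hv : v ∈ Ioo (0 : ℝ) 1) :
    Function.update u k v ∈ cube N := by
  intro j
  by_cases hj : j = k
  · subst hj; simpa using hv
  · rw [Function.update_of_ne hj]; exact hu j

/-- By monotonicity, the events `Q_k ≤ t` and `R_k ≤ t` are nested in the `k`-th coordinate. -/
theorem integral_abs_leInd_sub (hQ : IsQuantileProcess Q) (hR : IsQuantileProcess R) :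
    ∫ u, |leInd t (Q u k) - leInd t (R u k)| ∂lambdaN N
      = ∫ u, |levelProb Q k t u - levelProb R k t u| ∂lambdaN N := by
  rw [integral_eq_integral_update k (C := 1)]
  · refine integral_congr_ae ?_
    filter_upwards [ae_mem_cube N] with u hu
    have hanti : ∀ {S : (Fin N → ℝ) → Fin N → ℝ}, IsQuantileProcess S →
        ∀ v ∈ Ioo (0 : ℝ) 1, ∀ w ∈ Ioo (0 : ℝ) 1, v ≤ w →
        leInd t (S (Function.update u k w) k) ≤ leInd t (S (Function.update u k v) k) := by
      intro S hS v hv w hw hvw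
      refine leInd_antitone t (hS.inc k _ (mem_cube_update k hu hv) _ (mem_cube_update k hu hw)
        (fun j hj => ?_) (by simpa using hvw))
      rw [Function.update_of_ne hj.ne, Function.update_of_ne hj.ne]
    have hval : ∀ s x, leInd s x = 0 ∨ leInd s x = 1 := fun s x => by
      unfold leInd; split_ifs <;> simp
    have hnest :
        (∀ v ∈ Ioo (0 : ℝ) 1,
          leInd t (Q (Function.update u k v) k) ≤ leInd t (R (Function.update u k v) k)) ∨
        (∀ v ∈ Ioo (0 : ℝ) 1,
          leInd t (R (Function.update u k v) k) ≤ leInd t (Q (Function.update u k v) k)) := by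
      by_contra! h
      obtain ⟨⟨v, hv, hv'⟩, ⟨w, hw, hw'⟩⟩ := h
      rcases le_total v w with hvw | hvw
      · have := hanti hR v hv w hw hvw
        have := leInd_nonneg t (Q (Function.update u k w) k)
        rcases hval t (Q (Function.update u k v) k) with h | h <;>
        rcases hval t (R (Function.update u k v) k) with h' | h' <;> linarith
      · have := hanti hQ w hw v hv hvw
        have := leInd_nonneg t (R (Function.update u k v) k)
        rcases hval t (Q (Function.update u k w) k) with h | h <;>
        rcases hval t (R (Function.update u k w) k) with h' | h' <;> linarith
    have hI : ∀ᵐ v ∂lambda01, v ∈ Ioo (0 : ℝ) 1 := ae_restrict_mem measurableSet_Ioo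
    have hiQ := integrable_leInd_update k t hQ.measurable u
    have hiR := integrable_leInd_update k t hR.measurable u
    have hsub := integral_sub hiQ hiR
    rcases hnest with h | h
    · have : ∫ v, |leInd t (Q (Function.update u k v) k) - leInd t (R (Function.update u k v) k)|
          ∂lambda01 = -(levelProb Q k t u - levelProb R k t u) := by
        rw [levelProb, levelProb, ← hsub, ← integral_neg]
        refine integral_congr_ae ?_
        filter_upwards [hI] with v hv
        exact abs_of_nonpos (sub_nonpos.2 (h v hv))
      rw [this, eq_comm, abs_of_nonpos]
      exact neg_nonneg.1 (this ▸ integral_nonneg fun _ => abs_nonneg _)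
    · have : ∫ v, |leInd t (Q (Function.update u k v) k) - leInd t (R (Function.update u k v) k)|
          ∂lambda01 = levelProb Q k t u - levelProb R k t u := by
        rw [levelProb, levelProb, ← hsub]
        refine integral_congr_ae ?_
        filter_upwards [hI] with v hv
        exact abs_of_nonneg (sub_nonneg.2 (h v hv))
      rw [this, eq_comm, abs_of_nonneg]
      exact this ▸ integral_nonneg fun _ => abs_nonneg _
  · exact ((measurable_leInd_comp k t hQ.measurable).sub
      (measurable_leInd_comp k t hR.measurable)).abs
  · intro u
    rw [abs_abs]
    exact abs_leInd_sub_le_one _ _ _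

/-- By the consistency condition, `Q_k` is determined by `Q_1, …, Q_{k-1}` and the `k`-th
coordinate. -/
theorem IsQuantileProcess.apply_eq_of_trunc_eq (hQ : IsQuantileProcess Q) {u w : Fin N → ℝ}
    (hu : u ∈ cube N) (hw : w ∈ cube N) (huw : trunc k (Q u) = trunc k (Q w)) (hk : u k = w k) :
    Q u k = Q w k := by
  let z : ℕ → Fin N → ℝ := fun i j => if (j : ℕ) < i then w j else u j
  have hz : ∀ i, z i ∈ cube N := fun i j => by
    by_cases h : (j : ℕ) < i
    · simpa [z, h] using hw j
    · simpa [z, h] using hu j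
  have main : ∀ i : ℕ, i ≤ k → Q (z i) = Q u := by
    intro i
    induction i with
    | zero => intro _; congr 1
    | succ i ih =>
      intro hi
      have ih := ih (by omega)
      let i' : Fin N := ⟨i, by omega⟩
      have hdiff : ∀ j ≠ i', z (i + 1) j = z i j := fun j hj => by
        have : (j : ℕ) ≠ i := fun h => hj (Fin.ext h)
        simp only [z]
        congr 1
        simp only [eq_iff_iff]; omega
      have hi' : Q (z (i + 1)) i' = Q (z i) i' := by
        rw [ih, trunc_eq_trunc_iff.1 huw i' hi]
        refine hQ.triangular i' _ _ fun j hj => ?_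
        have : (j : ℕ) < i + 1 := Nat.lt_succ_of_le hj
        simp [z, this]
      ext m
      rw [← ih]
      by_cases hm : i' ≤ m
      · exact hQ.con i' m hm _ (hz _) _ (hz _) hdiff hi'
      · exact hQ.triangular m _ _ fun j hj => hdiff j (hj.trans_lt (not_le.1 hm)).ne
  rw [← main k le_rfl]
  refine hQ.triangular k _ _ fun j hj => ?_
  by_cases h : (j : ℕ) < k
  · simp [z, h]
  · have : j = k := le_antisymm hj (not_lt.1 h)
    subst this
    simpa [z] using hk

theorem IsQuantileProcess.exists_levelProb_eq (hQ : IsQuantileProcess Q) :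
    ∃ h : (Fin N → ℝ) → ℝ, Measurable h ∧
      ∀ u ∈ cube N, levelProb Q k t u = h (trunc k (Q u)) := by
  classical
  let r : (Fin N → ℝ) → Fin N → ℝ := fun u i => if u i ∈ Ioo (0 : ℝ) 1 then u i else 1 / 2
  have hr : Measurable r := measurable_pi_iff.2 fun i =>
    Measurable.ite (measurable_pi_apply i measurableSet_Ioo) (measurable_pi_apply i)
      measurable_const
  have hr_mem : ∀ u, r u ∈ cube N := fun u i => by
    by_cases h : u i ∈ Ioo (0 : ℝ) 1
    · simpa only [r, if_pos h] using h
    · simp only [r, if_neg h]; norm_num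
  have hr_id : ∀ u ∈ cube N, r u = u := fun u hu => by
    ext i; simp only [r, if_pos (hu i)]
  let f : (Fin N → ℝ) → Fin N → ℝ := fun u => trunc k (Q (r u))
  let G : (Fin N → ℝ) → ℝ := fun u => levelProb Q k t (r u)
  have hf : Measurable f := (measurable_trunc k).comp (hQ.measurable.comp hr)
  have hG : Measurable G := (measurable_levelProb k t hQ.measurable).comp hr
  have hfac : ∀ u w, f u = f w → G u = G w := by
    intro u w huw
    refine integral_congr_ae ?_
    filter_upwards [show ∀ᵐ v ∂lambda01, v ∈ Ioo (0 : ℝ) 1 from ae_restrict_mem measurableSet_Ioo]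
      with v hv
    rw [hQ.apply_eq_of_trunc_eq k (mem_cube_update k (hr_mem u) hv)
      (mem_cube_update k (hr_mem w) hv)]
    · rw [trunc_update k hQ.triangular, trunc_update k hQ.triangular]
      exact huw
    · simp
  let g : (Fin N → ℝ) → ℝ := Function.extend f G 0
  have hgf : g ∘ f = G := by
    ext u
    exact Function.FactorsThrough.extend_apply (fun u w => hfac u w) 0 u
  have hg : Measurable ((range f).domRestrict g) :=
    hf.measurable_comp_iff_restrict.1 (hgf ▸ hG)
  have hcomap : Measurable[MeasurableSpace.comap f inferInstance] G := by
    have : G = (range f).domRestrict g ∘ rangeFactorization f := by rw [← hgf]; rfl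
    rw [this]
    refine hg.comp (Measurable.subtype_mk (comap_measurable f))
  obtain ⟨h, hh, hGh⟩ := hcomap.exists_eq_measurable_comp
  refine ⟨h, hh, fun u hu => ?_⟩
  have := congrFun hGh u
  simpa only [G, f, Function.comp_apply, hr_id u hu] using this

end LevelProb

section Convergence

variable {N : ℕ}

open scoped BoundedContinuousFunction

theorem integral_abs_levelProb_sub_le {Q R : (Fin N → ℝ) → Fin N → ℝ} (hQ : IsQuantileProcess Q)
    (hR : IsQuantileProcess R) (k : Fin N) (t : ℝ) (g : (Fin N → ℝ) →ᵇ ℝ) :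
    ∫ u, |levelProb R k t u - g (trunc k (R u))| ∂lambdaN N
      ≤ ∫ u, |levelProb Q k t u - g (trunc k (Q u))| ∂lambdaN N
        + 2 * (1 + ‖g‖) * (TVdist ((lambdaN N).map R) ((lambdaN N).map Q)).toReal := by
  obtain ⟨h, hh, hRh⟩ := hR.exists_levelProb_eq k t
  let φ : (Fin N → ℝ) → ℝ := fun y => if g y ≤ h y then 1 else -1
  have hgm : Measurable g := g.continuous.measurable
  have hgC : ∀ x, |g x| ≤ ‖g‖ := g.norm_coe_le_norm
  have hφ : Measurable φ :=
    Measurable.ite (measurableSet_le hgm hh) measurable_const measurable_const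
  have hφ1 : ∀ x, |φ x| = 1 := fun x => by simp only [φ]; split_ifs <;> simp
  have hφabs : ∀ y, |h y - g y| = φ y * (h y - g y) := fun y => by
    simp only [φ]
    split_ifs with hy
    · rw [abs_of_nonneg (sub_nonneg.2 hy), one_mul]
    · rw [abs_of_neg (sub_neg.2 (not_le.1 hy))]; ring
  let F : (Fin N → ℝ) → ℝ := fun x => φ (trunc k x) * (leInd t (x k) - g (trunc k x))
  have hF : Measurable F :=
    (hφ.comp (measurable_trunc k)).mul
      ((measurable_leInd_comp k t measurable_id).sub (hgm.comp (measurable_trunc k)))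
  have hFC : ∀ x, |F x| ≤ 1 + ‖g‖ := fun x => by
    rw [abs_mul, hφ1, one_mul]
    exact (abs_sub _ _).trans (add_le_add
      ((abs_of_nonneg (leInd_nonneg _ _)).trans_le (leInd_le_one _ _)) (hgC _))
  have hpR := Measure.isProbabilityMeasure_map (μ := lambdaN N) hR.measurable.aemeasurable
  have hpQ := Measure.isProbabilityMeasure_map (μ := lambdaN N) hQ.measurable.aemeasurable
  have hT : Measurable fun u => trunc k (Q u) := (measurable_trunc k).comp hQ.measurable
  calc ∫ u, |levelProb R k t u - g (trunc k (R u))| ∂lambdaN N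
      = ∫ u, φ (trunc k (R u)) * (levelProb R k t u - g (trunc k (R u))) ∂lambdaN N := by
        refine integral_congr_ae ?_
        filter_upwards [ae_mem_cube N] with u hu
        rw [hRh u hu, hφabs]
    _ = ∫ u, F (R u) ∂lambdaN N :=
        (integral_mul_leInd_sub k t hR.measurable hR.triangular hφ hgm
          (fun x => (hφ1 x).le) hgC).symm
    _ = ∫ x, F x ∂(lambdaN N).map R :=
        (integral_map hR.measurable.aemeasurable hF.aestronglyMeasurable).symm
    _ ≤ ∫ x, F x ∂(lambdaN N).map Q
        + 2 * (1 + ‖g‖) * (TVdist ((lambdaN N).map R) ((lambdaN N).map Q)).toReal :=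
        integral_le_add_TVdist _ _ hF (by positivity) hFC
    _ = ∫ u, F (Q u) ∂lambdaN N
        + 2 * (1 + ‖g‖) * (TVdist ((lambdaN N).map R) ((lambdaN N).map Q)).toReal := by
        rw [integral_map hQ.measurable.aemeasurable hF.aestronglyMeasurable]
    _ = ∫ u, φ (trunc k (Q u)) * (levelProb Q k t u - g (trunc k (Q u))) ∂lambdaN N
        + 2 * (1 + ‖g‖) * (TVdist ((lambdaN N).map R) ((lambdaN N).map Q)).toReal := by
        rw [← integral_mul_leInd_sub k t hQ.measurable hQ.triangular hφ hgm
          (fun x => (hφ1 x).le) hgC]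
    _ ≤ _ := by
        refine add_le_add ?_ le_rfl
        refine (le_abs_self _).trans (abs_integral_le_integral_abs.trans_eq ?_)
        simp only [abs_mul, hφ1, one_mul]

theorem tendsto_integral_abs_levelProb_sub {Qn : ℕ → (Fin N → ℝ) → Fin N → ℝ}
    {Q : (Fin N → ℝ) → Fin N → ℝ} (hQn : ∀ n, IsQuantileProcess (Qn n)) (hQ : IsQuantileProcess Q)
    (htv : Tendsto (fun n => TVdist ((lambdaN N).map (Qn n)) ((lambdaN N).map Q)) atTop (𝓝 0))
    (k : Fin N) (t : ℝ)
    (hconv : ∀ᵐ u ∂lambdaN N,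
      Tendsto (fun n => trunc k (Qn n u)) atTop (𝓝 (trunc k (Q u)))) :
    Tendsto (fun n => ∫ u, |levelProb (Qn n) k t u - levelProb Q k t u| ∂lambdaN N)
      atTop (𝓝 0) := by
  have hT : Measurable fun u => trunc k (Q u) := (measurable_trunc k).comp hQ.measurable
  have hTn : ∀ n, Measurable fun u => trunc k (Qn n u) :=
    fun n => (measurable_trunc k).comp (hQn n).measurable
  have hp := Measure.isProbabilityMeasure_map (μ := lambdaN N) hT.aemeasurable
  obtain ⟨h, hh, hQh⟩ := hQ.exists_levelProb_eq k t
  have hQh' : levelProb Q k t =ᵐ[lambdaN N] h ∘ fun u => trunc k (Q u) := by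
    filter_upwards [ae_mem_cube N] with u hu using hQh u hu
  have hint : Integrable h ((lambdaN N).map fun u => trunc k (Q u)) :=
    (integrable_map_measure hh.aestronglyMeasurable hT.aemeasurable).2
      ((integrable_levelProb k t hQ.measurable).congr hQh')
  have htv' : Tendsto (fun n => (TVdist ((lambdaN N).map (Qn n)) ((lambdaN N).map Q)).toReal)
      atTop (𝓝 0) := by
    simpa [Function.comp_def] using (ENNReal.tendsto_toReal ENNReal.zero_ne_top).comp htv
  refine tendsto_order.2 ⟨fun a ha => Eventually.of_forall fun n =>
    ha.trans_le (integral_nonneg fun u => abs_nonneg _), fun ε hε => ?_⟩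
  obtain ⟨g, hg, -⟩ := hint.exists_boundedContinuous_integral_sub_le (ε := ε / 4) (by positivity)
  have hgm : Measurable g := g.continuous.measurable
  have hg' : ∫ u, |levelProb Q k t u - g (trunc k (Q u))| ∂lambdaN N ≤ ε / 4 := by
    refine le_trans (le_of_eq ?_) hg
    have hm : Measurable fun x => ‖h x - g x‖ := (hh.sub hgm).norm
    rw [integral_map hT.aemeasurable hm.aestronglyMeasurable]
    refine integral_congr_ae ?_
    filter_upwards [hQh'] with u hu
    rw [hu]; rfl
  have higS : ∀ {S : (Fin N → ℝ) → Fin N → ℝ}, Measurable S →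
      Integrable (fun u => g (trunc k (S u))) (lambdaN N) := fun {S} hS =>
    Integrable.of_bound (hgm.comp ((measurable_trunc k).comp hS)).aestronglyMeasurable ‖g‖
      (ae_of_all _ fun u => g.norm_coe_le_norm _)
  have hgconv : Tendsto (fun n => ∫ u, |g (trunc k (Qn n u)) - g (trunc k (Q u))| ∂lambdaN N)
      atTop (𝓝 0) := by
    have : Tendsto (fun n => ∫ u, |g (trunc k (Qn n u)) - g (trunc k (Q u))| ∂lambdaN N)
        atTop (𝓝 (∫ _, (0 : ℝ) ∂lambdaN N)) := by
      refine tendsto_integral_of_dominated_convergence (fun _ => ‖g‖ + ‖g‖)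
        (fun n => (((hgm.comp (hTn n)).sub (hgm.comp hT)).abs).aestronglyMeasurable)
        (integrable_const _) (fun n => ae_of_all _ fun u => ?_) ?_
      · rw [Real.norm_eq_abs, abs_abs]
        exact (abs_sub _ _).trans (add_le_add (g.norm_coe_le_norm _) (g.norm_coe_le_norm _))
      · filter_upwards [hconv] with u hu
        have := ((g.continuous.tendsto _).comp hu).sub_const (g (trunc k (Q u)))
        simpa using this.abs
    simpa using this
  have hlim : Tendsto (fun n => 2 * (1 + ‖g‖) *
      (TVdist ((lambdaN N).map (Qn n)) ((lambdaN N).map Q)).toReal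
      + ∫ u, |g (trunc k (Qn n u)) - g (trunc k (Q u))| ∂lambdaN N) atTop (𝓝 0) := by
    simpa using (htv'.const_mul (2 * (1 + ‖g‖))).add hgconv
  filter_upwards [hlim.eventually (gt_mem_nhds (half_pos hε))] with n hn
  have hmain := integral_abs_levelProb_sub_le hQ (hQn n) k t g
  have hiL : ∀ {S : (Fin N → ℝ) → Fin N → ℝ}, Measurable S →
      Integrable (fun u => |levelProb S k t u - g (trunc k (S u))|) (lambdaN N) := fun hS =>
    ((integrable_levelProb k t hS).sub (higS hS)).abs
  have hig : Integrable (fun u => |g (trunc k (Qn n u)) - g (trunc k (Q u))|) (lambdaN N) :=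
    ((higS (hQn n).measurable).sub (higS hQ.measurable)).abs
  have hiQ := hiL hQ.measurable
  have hiQn := hiL (hQn n).measurable
  have htri : ∫ u, |levelProb (Qn n) k t u - levelProb Q k t u| ∂lambdaN N
      ≤ ∫ u, |levelProb (Qn n) k t u - g (trunc k (Qn n u))| ∂lambdaN N
        + ∫ u, |g (trunc k (Qn n u)) - g (trunc k (Q u))| ∂lambdaN N
        + ∫ u, |levelProb Q k t u - g (trunc k (Q u))| ∂lambdaN N := by
    rw [← integral_add hiQn hig, ← integral_add (by exact hiQn.add hig) hiQ]
    refine integral_mono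
      ((integrable_levelProb k t (hQn n).measurable).sub
        (integrable_levelProb k t hQ.measurable)).abs
      ((hiQn.add hig).add hiQ) fun u => ?_
    simp only
    rw [abs_sub_comm (levelProb Q k t u)]
    refine (abs_sub_le _ (g (trunc k (Q u))) _).trans (add_le_add ?_ le_rfl)
    exact abs_sub_le _ _ _
  linarith

/-- The measure on the real line with distribution function `arctan`, up to a constant. -/
noncomputable def arctanMeasure : Measure ℝ :=
  volume.withDensity fun t => ENNReal.ofReal (1 + t ^ 2)⁻¹

instance : IsFiniteMeasure arctanMeasure :=
  isFiniteMeasure_withDensity_ofReal integrable_inv_one_add_sq.2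

theorem arctanMeasure_Ico {a b : ℝ} (h : a ≤ b) :
    arctanMeasure (Ico a b) = ENNReal.ofReal (Real.arctan b - Real.arctan a) := by
  rw [arctanMeasure, withDensity_apply _ measurableSet_Ico,
    ← ofReal_integral_eq_lintegral_ofReal integrable_inv_one_add_sq.integrableOn
      (ae_of_all _ fun t => by positivity), integral_Ico_eq_integral_Ioo,
    ← integral_Ioc_eq_integral_Ioo, ← intervalIntegral.integral_of_le h,
    integral_inv_one_add_sq]

theorem lintegral_enorm_leInd_sub (a b : ℝ) :
    ∫⁻ t, ‖leInd t a - leInd t b‖ₑ ∂arctanMeasure = ‖Real.arctan a - Real.arctan b‖ₑ := by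
  wlog h : a ≤ b generalizing a b
  · have := this b a (le_of_not_ge h)
    simp only [← enorm_neg (leInd _ a - _), ← enorm_neg (Real.arctan a - _), neg_sub]
    exact this
  have : ∀ t, ‖leInd t a - leInd t b‖ₑ = (Ico a b).indicator 1 t := fun t => by
    by_cases ht : t ∈ Ico a b
    · rw [indicator_of_mem ht]
      simp [leInd, ht.1, not_le.2 ht.2]
    · rw [indicator_of_notMem ht]
      have : leInd t a = leInd t b := by
        unfold leInd
        congr 1
        simp only [eq_iff_iff]
        exact ⟨fun h' => not_lt.1 fun h'' => ht ⟨h', h''⟩, h.trans⟩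
      simp [this]
  simp only [this]
  rw [lintegral_indicator_one measurableSet_Ico, arctanMeasure_Ico h, enorm_sub_rev,
    Real.enorm_of_nonneg (sub_nonneg.2 (Real.arctan_mono h))]

/-- Convergence of all the level events yields almost sure convergence along a subsequence. -/
theorem exists_subseq_tendsto_of_leInd {Ω : Type*} [MeasurableSpace Ω] {P : Measure Ω}
    [IsProbabilityMeasure P] {X : ℕ → Ω → ℝ} {Y : Ω → ℝ} (hX : ∀ n, Measurable (X n))
    (hY : Measurable Y)
    (h : ∀ t, Tendsto (fun n => ∫ ω, |leInd t (X n ω) - leInd t (Y ω)| ∂P) atTop (𝓝 0)) :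
    ∃ ns : ℕ → ℕ, StrictMono ns ∧
      ∀ᵐ ω ∂P, Tendsto (fun i => X (ns i) ω) atTop (𝓝 (Y ω)) := by
  have hmeas : ∀ n, Measurable fun z : ℝ × Ω => leInd z.1 (X n z.2) - leInd z.1 (Y z.2) :=
    fun n => (measurable_leInd.comp (measurable_fst.prodMk ((hX n).comp measurable_snd))).sub
      (measurable_leInd.comp (measurable_fst.prodMk (hY.comp measurable_snd)))
  have henorm : ∀ n t, ∫⁻ ω, ‖leInd t (X n ω) - leInd t (Y ω)‖ₑ ∂P
      = ENNReal.ofReal (∫ ω, |leInd t (X n ω) - leInd t (Y ω)| ∂P) := fun n t => by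
    have hm : Measurable fun ω => leInd t (X n ω) - leInd t (Y ω) :=
      (hmeas n).comp measurable_prodMk_left
    have hint : Integrable (fun ω => leInd t (X n ω) - leInd t (Y ω)) P :=
      Integrable.of_bound hm.aestronglyMeasurable 1
        (ae_of_all _ fun ω => abs_leInd_sub_le_one _ _ _)
    exact (ofReal_integral_norm_eq_lintegral_enorm hint).symm
  have hlim : Tendsto (fun n => ∫⁻ t, ∫⁻ ω, ‖leInd t (X n ω) - leInd t (Y ω)‖ₑ ∂P ∂arctanMeasure)
      atTop (𝓝 0) := by
    have : Tendsto (fun n => ∫⁻ t, ∫⁻ ω, ‖leInd t (X n ω) - leInd t (Y ω)‖ₑ ∂P ∂arctanMeasure)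
        atTop (𝓝 (∫⁻ _, 0 ∂arctanMeasure)) := by
      refine tendsto_lintegral_of_dominated_convergence (fun _ => 1)
        (fun n => (hmeas n).enorm.lintegral_prod_right') (fun n => ae_of_all _ fun t => ?_)
        (by simp) (ae_of_all _ fun t => ?_)
      · calc ∫⁻ ω, ‖leInd t (X n ω) - leInd t (Y ω)‖ₑ ∂P ≤ ∫⁻ _, 1 ∂P :=
              lintegral_mono fun ω => by
                rw [Real.enorm_eq_ofReal_abs, ENNReal.ofReal_le_one]
                exact abs_leInd_sub_le_one _ _ _
          _ = 1 := by simp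
      · simp only [henorm]
        simpa using ENNReal.tendsto_ofReal (h t)
    simpa using this
  have hL1 : Tendsto (fun n => eLpNorm ((fun ω => Real.arctan (X n ω)) -
      fun ω => Real.arctan (Y ω)) 1 P) atTop (𝓝 0) := by
    refine hlim.congr fun n => ?_
    rw [lintegral_lintegral_swap (hmeas n).enorm.aemeasurable, eLpNorm_one_eq_lintegral_enorm]
    exact lintegral_congr fun ω => lintegral_enorm_leInd_sub _ _
  obtain ⟨ns, hns, hae⟩ := (tendstoInMeasure_of_tendsto_eLpNorm one_ne_zero
    (fun n => (Real.measurable_arctan.comp (hX n)).aestronglyMeasurable)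
    (Real.measurable_arctan.comp hY).aestronglyMeasurable hL1).exists_seq_tendsto_ae
  refine ⟨ns, hns, ?_⟩
  filter_upwards [hae] with ω hω
  have hcont : ContinuousAt Real.tan (Real.arctan (Y ω)) :=
    Real.continuousAt_tan.2 (Real.cos_arctan_pos _).ne'
  have := hcont.tendsto.comp hω
  simpa [Function.comp_def, Real.tan_arctan] using this

theorem exists_subseq_tendsto_trunc {Qn : ℕ → (Fin N → ℝ) → Fin N → ℝ}
    {Q : (Fin N → ℝ) → Fin N → ℝ} (hQn : ∀ n, IsQuantileProcess (Qn n)) (hQ : IsQuantileProcess Q)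
    (htv : Tendsto (fun n => TVdist ((lambdaN N).map (Qn n)) ((lambdaN N).map Q)) atTop (𝓝 0))
    {k : ℕ} (hk : k ≤ N) :
    ∃ ns : ℕ → ℕ, StrictMono ns ∧ ∀ᵐ u ∂lambdaN N,
      Tendsto (fun i => trunc k (Qn (ns i) u)) atTop (𝓝 (trunc k (Q u))) := by
  induction k with
  | zero =>
    refine ⟨id, strictMono_id, ae_of_all _ fun u => ?_⟩
    simp only [trunc_zero]
    exact tendsto_const_nhds
  | succ k ih =>
    obtain ⟨ns, hns, hae⟩ := ih (by omega)
    let k' : Fin N := ⟨k, hk⟩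
    have hlevel : ∀ t, Tendsto (fun n => ∫ u, |leInd t (Qn (ns n) u k') - leInd t (Q u k')|
        ∂lambdaN N) atTop (𝓝 0) := fun t => by
      refine (tendsto_integral_abs_levelProb_sub (fun n => hQn (ns n)) hQ
        (htv.comp hns.tendsto_atTop) k' t hae).congr fun n => ?_
      exact (integral_abs_leInd_sub k' t (hQn _) hQ).symm
    obtain ⟨ms, hms, hae'⟩ := exists_subseq_tendsto_of_leInd
      (fun n => (measurable_pi_apply k').comp (hQn (ns n)).measurable)
      ((measurable_pi_apply k').comp hQ.measurable) hlevel
    refine ⟨ns ∘ ms, hns.comp hms, ?_⟩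
    filter_upwards [hae, hae'] with u hu hu'
    have h1 : ∀ x : Fin N → ℝ, trunc (k + 1) x = Function.update (trunc k x) k' (x k') :=
      trunc_succ k'
    simp only [h1]
    exact (hu.comp hms.tendsto_atTop).update k' hu'

theorem exists_subseq_tendsto_ae {Qn : ℕ → (Fin N → ℝ) → Fin N → ℝ}
    {Q : (Fin N → ℝ) → Fin N → ℝ} (hQn : ∀ n, IsQuantileProcess (Qn n)) (hQ : IsQuantileProcess Q)
    (htv : Tendsto (fun n => TVdist ((lambdaN N).map (Qn n)) ((lambdaN N).map Q)) atTop (𝓝 0)) :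
    ∃ ns : ℕ → ℕ, StrictMono ns ∧ ∀ᵐ u ∂lambdaN N,
      Tendsto (fun i => Qn (ns i) u) atTop (𝓝 (Q u)) := by
  simpa only [trunc_self] using exists_subseq_tendsto_trunc hQn hQ htv le_rfl

/-- A generalized dominated convergence theorem with varying dominating functions. -/
theorem tendsto_lintegral_zero_of_le_of_tendsto {Ω : Type*} [MeasurableSpace Ω] {P : Measure Ω}
    {c b : ℕ → Ω → ℝ≥0∞} {B : Ω → ℝ≥0∞} (hc : ∀ n, Measurable (c n)) (hb : ∀ n, Measurable (b n))
    (hcb : ∀ n ω, c n ω ≤ b n ω) (hBtop : ∀ ω, B ω ≠ ⊤)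
    (hBint : ∫⁻ ω, B ω ∂P ≠ ⊤)
    (hblim : ∀ᵐ ω ∂P, Tendsto (fun n => b n ω) atTop (𝓝 (B ω)))
    (hbint : Tendsto (fun n => ∫⁻ ω, b n ω ∂P) atTop (𝓝 (∫⁻ ω, B ω ∂P)))
    (hclim : ∀ᵐ ω ∂P, Tendsto (fun n => c n ω) atTop (𝓝 0)) :
    Tendsto (fun n => ∫⁻ ω, c n ω ∂P) atTop (𝓝 0) := by
  have hsum : ∀ n, ∫⁻ ω, (b n ω - c n ω) ∂P + ∫⁻ ω, c n ω ∂P = ∫⁻ ω, b n ω ∂P := fun n => by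
    rw [← lintegral_add_right _ (hc n)]
    exact lintegral_congr fun ω => tsub_add_cancel_of_le (hcb n ω)
  have hfatou : ∫⁻ ω, B ω ∂P ≤ liminf (fun n => ∫⁻ ω, (b n ω - c n ω) ∂P) atTop := by
    refine le_trans (lintegral_mono_ae ?_) (lintegral_liminf_le fun n => (hb n).sub (hc n))
    filter_upwards [hblim, hclim] with ω h1 h2
    have := ENNReal.Tendsto.sub h1 h2 (Or.inl (hBtop ω))
    rw [tsub_zero] at this
    exact this.liminf_eq.ge
  rw [ENNReal.tendsto_nhds_zero]
  intro ε hε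
  by_cases hB0 : ∫⁻ ω, B ω ∂P = 0
  · rw [hB0] at hbint
    filter_upwards [(ENNReal.tendsto_nhds_zero.1 hbint) ε hε] with n hn
    exact (lintegral_mono (hcb n)).trans hn
  have hε2 : ε / 2 ≠ 0 := (ENNReal.half_pos hε.ne').ne'
  have hlt : ∫⁻ ω, B ω ∂P - ε / 2 < liminf (fun n => ∫⁻ ω, (b n ω - c n ω) ∂P) atTop :=
    (ENNReal.sub_lt_self hBint hB0 hε2).trans_le hfatou
  have hle := ((ENNReal.tendsto_nhds hBint).1 hbint) (ε / 2) (ENNReal.half_pos hε.ne')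
  filter_upwards [eventually_lt_of_lt_liminf hlt, hle] with n h1 h2
  rcases eq_or_ne ε ⊤ with rfl | hεtop
  · exact le_top
  have h3 : ∫⁻ ω, (b n ω - c n ω) ∂P ≠ ⊤ :=
    ne_top_of_le_ne_top (ENNReal.add_ne_top.2 ⟨hBint, ENNReal.div_ne_top hεtop two_ne_zero⟩)
      ((lintegral_mono fun ω => tsub_le_self).trans h2.2)
  rw [← ENNReal.add_le_add_iff_left h3, hsum n]
  calc ∫⁻ ω, b n ω ∂P ≤ ∫⁻ ω, B ω ∂P + ε / 2 := h2.2
    _ ≤ ∫⁻ ω, (b n ω - c n ω) ∂P + ε / 2 + ε / 2 := by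
      gcongr
      exact tsub_le_iff_right.1 h1.le
    _ = ∫⁻ ω, (b n ω - c n ω) ∂P + ε := by rw [add_assoc, ENNReal.add_halves]

/-- The `p`-th moment function `|x|_p^p`. -/
noncomputable def pMoment (p : ℝ) (x : Fin N → ℝ) : ℝ≥0∞ :=
  ∑ k, ENNReal.ofReal (|x k| ^ p)

theorem continuous_pMoment {p : ℝ} (hp : 0 ≤ p) : Continuous (pMoment p : (Fin N → ℝ) → ℝ≥0∞) :=
  continuous_finsetSum _ fun k _ => ENNReal.continuous_ofReal.comp <|
    (continuous_apply k).abs.rpow_const fun _ => Or.inr hp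

theorem pMoment_ne_top (p : ℝ) (x : Fin N → ℝ) : pMoment p x ≠ ⊤ :=
  ENNReal.sum_ne_top.2 fun _ _ => ENNReal.ofReal_ne_top

theorem pCost_le {p : ℝ} (hp : 1 ≤ p) (x y : Fin N → ℝ) :
    pCost p x y ≤ 2 ^ (p - 1) * (pMoment p x + pMoment p y) := by
  have hp0 : 0 ≤ p := zero_le_one.trans hp
  rw [pCost, pMoment, pMoment, ← Finset.sum_add_distrib, Finset.mul_sum]
  refine Finset.sum_le_sum fun k _ => ?_
  simp only [← ENNReal.ofReal_rpow_of_nonneg (abs_nonneg _) hp0]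
  refine le_trans ?_ (ENNReal.rpow_add_le_mul_rpow_add_rpow _ _ hp)
  rw [← ENNReal.ofReal_add (abs_nonneg _) (abs_nonneg _)]
  exact ENNReal.rpow_le_rpow (ENNReal.ofReal_le_ofReal (abs_sub _ _)) hp0

theorem pMoment_zero {p : ℝ} (hp : p ≠ 0) : pMoment p (0 : Fin N → ℝ) = 0 := by
  simp [pMoment, Real.zero_rpow hp]

theorem measurable_cost0 {S T : (Fin N → ℝ) → Fin N → ℝ} (hS : Measurable S) (hT : Measurable T) :
    Measurable fun u => cost0 (S u) (T u) :=
  ((hS.sub hT).norm.min measurable_const).ennreal_ofReal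

theorem tendsto_lintegral_cost0 {Sn : ℕ → (Fin N → ℝ) → Fin N → ℝ} {S : (Fin N → ℝ) → Fin N → ℝ}
    (hSn : ∀ n, Measurable (Sn n)) (hS : Measurable S)
    (hlim : ∀ᵐ u ∂lambdaN N, Tendsto (fun n => Sn n u) atTop (𝓝 (S u))) :
    Tendsto (fun n => ∫⁻ u, cost0 (Sn n u) (S u) ∂lambdaN N) atTop (𝓝 0) := by
  have h : Tendsto (fun n => ∫⁻ u, cost0 (Sn n u) (S u) ∂lambdaN N) atTop
      (𝓝 (∫⁻ _, 0 ∂lambdaN N)) := by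
    refine tendsto_lintegral_of_dominated_convergence (fun _ => 1)
      (fun n => measurable_cost0 (hSn n) hS)
      (fun n => ae_of_all _ fun u => ?_) (by simp) ?_
    · exact ENNReal.ofReal_le_one.2 (min_le_right _ _)
    · filter_upwards [hlim] with u hu
      have h := (hu.sub_const (S u)).norm.min (tendsto_const_nhds (x := (1 : ℝ)))
      simpa [cost0] using ENNReal.tendsto_ofReal h
  simpa using h

theorem tendsto_lintegral_pCost {p : ℝ} (hp : 1 ≤ p) {Sn : ℕ → (Fin N → ℝ) → Fin N → ℝ}
    {S : (Fin N → ℝ) → Fin N → ℝ} (hSn : ∀ n, Measurable (Sn n)) (hS : Measurable S)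
    (hlim : ∀ᵐ u ∂lambdaN N, Tendsto (fun n => Sn n u) atTop (𝓝 (S u)))
    (hfin : ∫⁻ u, pMoment p (S u) ∂lambdaN N ≠ ⊤)
    (hmom : Tendsto (fun n => ∫⁻ u, pMoment p (Sn n u) ∂lambdaN N) atTop
      (𝓝 (∫⁻ u, pMoment p (S u) ∂lambdaN N))) :
    Tendsto (fun n => ∫⁻ u, pCost p (Sn n u) (S u) ∂lambdaN N) atTop (𝓝 0) := by
  have hp0 : 0 ≤ p := zero_le_one.trans hp
  have hC : (2 : ℝ≥0∞) ^ (p - 1) ≠ ⊤ :=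
    ENNReal.rpow_ne_top_of_nonneg (sub_nonneg.2 hp) ENNReal.ofNat_ne_top
  have hM : ∀ {T : (Fin N → ℝ) → Fin N → ℝ}, Measurable T → Measurable fun u => pMoment p (T u) :=
    fun hT => (continuous_pMoment hp0).measurable.comp hT
  have hint : ∀ {T : (Fin N → ℝ) → Fin N → ℝ}, Measurable T →
      ∫⁻ u, 2 ^ (p - 1) * (pMoment p (T u) + pMoment p (S u)) ∂lambdaN N
        = 2 ^ (p - 1) * (∫⁻ u, pMoment p (T u) ∂lambdaN N
          + ∫⁻ u, pMoment p (S u) ∂lambdaN N) := fun hT => by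
    rw [← lintegral_add_left (hM hT), ← lintegral_const_mul _ (by exact (hM hT).add (hM hS))]
  refine tendsto_lintegral_zero_of_le_of_tendsto
    (b := fun n u => 2 ^ (p - 1) * (pMoment p (Sn n u) + pMoment p (S u)))
    (B := fun u => 2 ^ (p - 1) * (pMoment p (S u) + pMoment p (S u)))
    (c := fun n u => pCost p (Sn n u) (S u))
    (fun n => hM ((hSn n).sub hS))
    (fun n => ((hM (hSn n)).add (hM hS)).const_mul _) (fun n u => pCost_le hp _ _)
    (fun u => ENNReal.mul_ne_top hC
      (ENNReal.add_ne_top.2 ⟨pMoment_ne_top _ _, pMoment_ne_top _ _⟩)) ?_ ?_ ?_ ?_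
  · rw [hint hS]
    exact ENNReal.mul_ne_top hC (ENNReal.add_ne_top.2 ⟨hfin, hfin⟩)
  · filter_upwards [hlim] with u hu
    exact ENNReal.Tendsto.const_mul
      ((((continuous_pMoment hp0).tendsto _).comp hu).add tendsto_const_nhds) (Or.inr hC)
  · simp only [hint hS, hint (hSn _)]
    exact ENNReal.Tendsto.const_mul (hmom.add tendsto_const_nhds) (Or.inr hC)
  · filter_upwards [hlim] with u hu
    have h := ((continuous_pMoment hp0).tendsto (S u - S u)).comp (hu.sub_const (S u))
    rwa [sub_self, pMoment_zero (by linarith)] at h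

end Convergence

/-- If `μₙ → μ` in total variation and (when `p ≥ 1`) the `p`-th moments
converge, then `Q^{μₙ} → Q^μ` in `L_p(λ^N; ℝ^N)` (in probability when `p = 0`). -/
theorem quantileProcess_tendsto_of_tendsto_TV (N : ℕ) (p : ℝ) (hp : p = 0 ∨ 1 ≤ p)
    (μn : ℕ → Measure (Fin N → ℝ)) (μ : Measure (Fin N → ℝ))
    (hμn : ∀ n, MemPp p (μn n)) (hμ : MemPp p μ)
    (htv : Tendsto (fun n => TVdist (μn n) μ) atTop (𝓝 0))
    (hmom : 1 ≤ p →
      Tendsto (fun n => ∫⁻ x, ∑ k, ENNReal.ofReal (|x k| ^ p) ∂(μn n)) atTop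
        (𝓝 (∫⁻ x, ∑ k, ENNReal.ofReal (|x k| ^ p) ∂μ))) :
    Tendsto (fun n => Ldist p (quantileProcess (μn n)) (quantileProcess μ)) atTop (𝓝 0) := by
  have hprob := fun n => (hμn n).1
  have := hμ.1
  have hQ := quantileProcess_spec μ
  have hQn := fun n => quantileProcess_spec (μn n)
  refine tendsto_of_subseq_tendsto fun ns hns => ?_
  obtain ⟨ms, hms, hlim⟩ := exists_subseq_tendsto_ae (fun i => (hQn (ns i)).1) hQ.1
    (by simpa only [(hQn _).2, hQ.2, Function.comp_def] using htv.comp hns)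
  refine ⟨ms, ?_⟩
  have hSn := fun i => (hQn (ns (ms i))).1.measurable
  rcases eq_or_ne p 0 with rfl | hp0
  · simpa only [Ldist, if_true] using tendsto_lintegral_cost0 hSn hQ.1.measurable hlim
  have hp1 : 1 ≤ p := hp.resolve_left hp0
  have hpos : 0 < p := zero_lt_one.trans_le hp1
  have hM : ∀ {T : (Fin N → ℝ) → Fin N → ℝ} {ν : Measure (Fin N → ℝ)},
      IsQuantileProcess T ∧ (lambdaN N).map T = ν →
        ∫⁻ u, pMoment p (T u) ∂lambdaN N = ∫⁻ x, ∑ k, ENNReal.ofReal (|x k| ^ p) ∂ν := by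
    rintro T _ ⟨hT, rfl⟩
    exact (lintegral_map (continuous_pMoment hpos.le).measurable hT.measurable).symm
  have hcost := tendsto_lintegral_pCost hp1 hSn hQ.1.measurable hlim
    (by rw [hM hQ]; exact (hμ.2.resolve_left hp0).ne)
    (by
      simp only [hM hQ, hM (hQn _)]
      exact (hmom hp1).comp (hns.comp hms.tendsto_atTop))
  have := ((ENNReal.continuous_rpow_const (y := p⁻¹)).tendsto 0).comp hcost
  rw [ENNReal.zero_rpow_of_pos (inv_pos.2 hpos)] at this
  simpa only [Ldist, if_neg hp0, Function.comp_def] using this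
end

section
/- For every p ∈ {0} ∪ [1,∞), the set L^IT_p(λ^N) of (λ^N-equivalence classes of) p-integrable triangular increasing maps (0,1)^N → ℝ^N is a closed subset of L_p(λ^N; ℝ^N). -/
open MeasureTheory ProbabilityTheory Filter Set
open scoped ENNReal NNReal Topology

/-- An increasing triangular transformation: a Borel triangular map satisfying (inc) on a
`λ^N`-full subset of the unit cube. -/
def IncreasingTriangular {N : ℕ} (T : (Fin N → ℝ) → Fin N → ℝ) : Prop :=
  Measurable T ∧ Triangular T ∧
    ∃ Γ : Set (Fin N → ℝ), Γ ⊆ cube N ∧ lambdaN N Γᶜ = 0 ∧ IncOn T Γ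

/-- A strictly increasing triangular transformation: a Borel triangular map satisfying (sinc)
on a `λ^N`-full subset of the unit cube. -/
def StrictlyIncreasingTriangular {N : ℕ} (T : (Fin N → ℝ) → Fin N → ℝ) : Prop :=
  Measurable T ∧ Triangular T ∧
    ∃ Γ : Set (Fin N → ℝ), Γ ⊆ cube N ∧ lambdaN N Γᶜ = 0 ∧ StrictIncOn T Γ

/-- Convergence in measure from convergence of integrals of a cost that is bounded below away from
the diagonal. -/
theorem tendstoInMeasure_of_tendsto_lintegral_cost {α E : Type*} [MeasurableSpace α]
    {μ : Measure α} [SeminormedAddCommGroup E] {f : ℕ → α → E} {g : α → E} {c : ℕ → α → ℝ≥0∞}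
    (hc : ∀ n, Measurable (c n))
    (hlow : ∀ ε : ℝ, 0 < ε → ∃ δ : ℝ, 0 < δ ∧
      ∀ n u, ε ≤ ‖f n u - g u‖ → ENNReal.ofReal δ ≤ c n u)
    (hlim : Tendsto (fun n => ∫⁻ u, c n u ∂μ) atTop (𝓝 0)) :
    TendstoInMeasure μ f atTop g := by
  rw [tendstoInMeasure_iff_norm]
  intro ε hε
  obtain ⟨δ, hδ, h⟩ := hlow ε hε
  have hδ0 : ENNReal.ofReal δ ≠ 0 := by simpa using hδ
  have hbound : Tendsto (fun n => (∫⁻ u, c n u ∂μ) / ENNReal.ofReal δ) atTop (𝓝 0) := by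
    simpa using ENNReal.Tendsto.div_const hlim (Or.inr hδ0)
  refine tendsto_of_tendsto_of_tendsto_of_le_of_le tendsto_const_nhds hbound
    (fun _ => zero_le) fun n => ?_
  exact (measure_mono fun u hu => h n u hu).trans
    (meas_ge_le_lintegral_div (hc n).aemeasurable hδ0 ENNReal.ofReal_ne_top)

/-- Convergence in the `L_p`-distance implies convergence in measure. -/
theorem tendstoInMeasure_of_tendsto_Ldist {N : ℕ} {p : ℝ} (hp : p = 0 ∨ 1 ≤ p)
    {T : ℕ → (Fin N → ℝ) → Fin N → ℝ} {S : (Fin N → ℝ) → Fin N → ℝ}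
    (hT : ∀ n, Measurable (T n)) (hS : Measurable S)
    (hconv : Tendsto (fun n => Ldist p (T n) S) atTop (𝓝 0)) :
    TendstoInMeasure (lambdaN N) T atTop S := by
  rcases hp with rfl | hp
  · simp only [Ldist, if_true] at hconv
    refine tendstoInMeasure_of_tendsto_lintegral_cost (fun n => ?_) (fun ε hε => ?_) hconv
    · have hTn := hT n
      unfold cost0
      fun_prop
    · exact ⟨min ε 1, by positivity,
        fun n u h => ENNReal.ofReal_le_ofReal (min_le_min_right 1 h)⟩
  · have hp0 : 0 < p := by linarith
    simp only [Ldist, if_neg hp0.ne'] at hconv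
    have hlim : Tendsto (fun n => ∫⁻ u, pCost p (T n u) (S u) ∂(lambdaN N)) atTop (𝓝 0) := by
      have h := hconv.ennrpow_const p
      simpa only [← ENNReal.rpow_mul, inv_mul_cancel₀ hp0.ne', ENNReal.rpow_one,
        ENNReal.zero_rpow_of_pos hp0] using h
    refine tendstoInMeasure_of_tendsto_lintegral_cost (fun n => ?_) (fun ε hε => ?_) hlim
    · have hTn := hT n
      unfold pCost
      fun_prop
    · refine ⟨ε ^ p, by positivity, fun n u h => ?_⟩
      obtain ⟨k, hk⟩ : ∃ k, ε ≤ ‖(T n u - S u) k‖ := by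
        by_contra! hlt
        exact h.not_gt ((pi_norm_lt_iff hε).2 hlt)
      calc ENNReal.ofReal (ε ^ p) ≤ ENNReal.ofReal (|T n u k - S u k| ^ p) :=
            ENNReal.ofReal_le_ofReal (Real.rpow_le_rpow hε.le hk hp0.le)
        _ ≤ pCost p (T n u) (S u) :=
            Finset.single_le_sum (f := fun k => ENNReal.ofReal (|T n u k - S u k| ^ p))
              (fun _ _ => zero_le) (Finset.mem_univ k)

/-- An a.e. limit of increasing triangular maps is a.e. equal to an increasing triangular map,
namely the componentwise limit superior. -/
theorem IncreasingTriangular.exists_ae_eq_of_tendsto_ae {N : ℕ}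
    {T : ℕ → (Fin N → ℝ) → Fin N → ℝ} {S : (Fin N → ℝ) → Fin N → ℝ}
    (hT : ∀ n, IncreasingTriangular (T n))
    (hlim : ∀ᵐ u ∂(lambdaN N), Tendsto (fun n => T n u) atTop (𝓝 (S u))) :
    ∃ S' : (Fin N → ℝ) → Fin N → ℝ, IncreasingTriangular S' ∧ S =ᵐ[lambdaN N] S' := by
  choose hmeas htri Γ hcube hnull hinc using hT
  have hΓ : ∀ᵐ u ∂(lambdaN N), ∀ n, u ∈ Γ n := ae_all_iff.2 fun n => mem_ae_iff.2 (hnull n)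
  have heq : ∀ u, Tendsto (fun n => T n u) atTop (𝓝 (S u)) →
      ∀ k, limsup (fun n => T n u k) atTop = S u k :=
    fun u hu k => (tendsto_pi_nhds.1 hu k).limsup_eq
  refine ⟨fun u k => limsup (fun n => T n u k) atTop, ⟨?_, ?_,
    {u | (∀ n, u ∈ Γ n) ∧ Tendsto (fun n => T n u) atTop (𝓝 (S u))}, ?_, ?_, ?_⟩, ?_⟩
  · exact measurable_pi_lambda _ fun k =>
      Measurable.limsup fun n => (measurable_pi_apply k).comp (hmeas n)
  · intro k u v huv
    simp only [fun n => htri n k u v huv]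
  · exact fun u hu => hcube 0 (hu.1 0)
  · exact mem_ae_iff.1 (hΓ.and hlim)
  · rintro k u ⟨huΓ, hu⟩ v ⟨hvΓ, hv⟩ huv hle
    simp only [heq u hu k, heq v hv k]
    exact le_of_tendsto_of_tendsto' (tendsto_pi_nhds.1 hu k) (tendsto_pi_nhds.1 hv k)
      fun n => hinc n k u (huΓ n) v (hvΓ n) huv hle
  · filter_upwards [hlim] with u hu
    exact funext fun k => (heq u hu k).symm

/-- For `p ∈ {0} ∪ [1,∞)` the set `L^IT_p(λ^N)` of `p`-integrable triangular
increasing maps is closed in `L_p(λ^N; ℝ^N)` (expressed via sequential closedness): any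
`L_p`-limit of `p`-integrable increasing triangular maps is a.e. equal to an increasing
triangular map. -/
theorem LIT_closed (N : ℕ) (p : ℝ) (hp : p = 0 ∨ 1 ≤ p)
    (T : ℕ → (Fin N → ℝ) → Fin N → ℝ) (S : (Fin N → ℝ) → Fin N → ℝ)
    (hT : ∀ n, IncreasingTriangular (T n) ∧ FinLp p (T n))
    (hS : Measurable S) (hSp : FinLp p S)
    (hconv : Tendsto (fun n => Ldist p (T n) S) atTop (𝓝 0)) :
    ∃ S' : (Fin N → ℝ) → Fin N → ℝ, IncreasingTriangular S' ∧ S =ᵐ[lambdaN N] S' := by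
  obtain ⟨ns, -, hns⟩ := (tendstoInMeasure_of_tendsto_Ldist hp (fun n => (hT n).1.1) hS
    hconv).exists_seq_tendsto_ae
  exact IncreasingTriangular.exists_ae_eq_of_tendsto_ae (fun i => (hT (ns i)).1) hns
end
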